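/- Let S² be the unit sphere in ℝ³ with its standard smooth manifold structure, and let f, g : S² → ℝ be smooth functions each having exactly two critical points. Then f and g are topologically conjugate: there exist a homeomorphism h : S² → S² and a strictly increasing homeomorphism h' : ℝ → ℝ such that f ∘ h = h' ∘ g. -/

import Mathlib

open Manifold

open Set Filter Topology

section FlowExistence

variable {E : Type*} [NormedAddCommGroup E] [NormedSpace ℝ E]

/-- A bounded Lipschitz vector field has global integral curves. -/
theorem exists_forall_hasDerivAt_of_lipschitz [CompleteSpace E] {V : E → E} {K C : NNReal}
    (hV : LipschitzWith K V) (hC : ∀ x, ‖V x‖ ≤ C) (x : E) :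
    ∃ γ : ℝ → E, γ 0 = x ∧ ∀ t, HasDerivAt γ (V (γ t)) t := by
  have hloc : ∀ n : NNReal, ∃ γ : ℝ → E, γ 0 = x ∧
      ∀ t ∈ Ioo (-(n : ℝ)) n, HasDerivAt γ (V (γ t)) t := by
    intro n
    have h0 : (0 : ℝ) ∈ Icc (-(n : ℝ)) n := by simp
    have hPL : IsPicardLindelof (fun _ => V) (⟨0, h0⟩ : Icc (-(n : ℝ)) n) x (C * n) 0 C K :=
      IsPicardLindelof.of_time_independent (fun y _ => hC y) hV.lipschitzOnWith (by simp)
    obtain ⟨γ, hγ0, hγ⟩ := hPL.exists_eq_forall_mem_Icc_hasDerivWithinAt₀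
    exact ⟨γ, hγ0, fun t ht =>
      (hγ t (Ioo_subset_Icc_self ht)).hasDerivAt (Icc_mem_nhds ht.1 ht.2)⟩
  choose γ hγ0 hγ using hloc
  have heq : ∀ m n : NNReal, m ≤ n → EqOn (γ m) (γ n) (Ioo (-(m : ℝ)) m) := by
    intro m n hmn t ht
    have hm : (0 : ℝ) < m := by have := ht.1.trans ht.2; linarith
    have hmn' : (m : ℝ) ≤ n := hmn
    exact ODE_solution_unique_of_mem_Ioo (v := fun _ => V) (s := fun _ => univ) (K := K)
      (fun _ _ => hV.lipschitzOnWith) (t₀ := 0) ⟨by linarith, hm⟩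
      (fun s hs => ⟨hγ m s hs, trivial⟩)
      (fun s hs => ⟨hγ n s ⟨by linarith [hs.1], by linarith [hs.2]⟩, trivial⟩)
      (by rw [hγ0, hγ0]) ht
  have hmem : ∀ t : ℝ, t ∈ Ioo (-((‖t‖₊ + 1 : NNReal) : ℝ)) ((‖t‖₊ + 1 : NNReal) : ℝ) := by
    intro t
    rw [mem_Ioo, ← abs_lt]
    simp
  refine ⟨fun t => γ (‖t‖₊ + 1) t, hγ0 _, fun t => ?_⟩
  refine (hγ (‖t‖₊ + 1) t (hmem t)).congr_of_eventuallyEq ?_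
  filter_upwards [Ioo_mem_nhds (hmem t).1 (hmem t).2] with s hs
  rcases le_total (‖t‖₊ + 1) (‖s‖₊ + 1) with h | h
  · exact (heq _ _ h hs).symm
  · exact heq _ _ h (hmem s)

theorem dist_le_of_hasDerivAt_of_nonneg {V : E → E} {K : NNReal} (hV : LipschitzWith K V)
    {α β : ℝ → E} (hα : ∀ t, HasDerivAt α (V (α t)) t) (hβ : ∀ t, HasDerivAt β (V (β t)) t)
    {t : ℝ} (ht : 0 ≤ t) : dist (α t) (β t) ≤ dist (α 0) (β 0) * Real.exp (K * t) := by
  have := dist_le_of_trajectories_ODE (v := fun _ => V) (a := 0) (b := t) (fun _ => hV)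
    (fun s _ => (hα s).continuousAt.continuousWithinAt) (fun s _ => (hα s).hasDerivWithinAt)
    (fun s _ => (hβ s).continuousAt.continuousWithinAt) (fun s _ => (hβ s).hasDerivWithinAt)
    le_rfl t ⟨ht, le_rfl⟩
  simpa using this

/-- Integral curves of a Lipschitz vector field diverge at most exponentially, in both time
directions. -/
theorem dist_le_of_hasDerivAt {V : E → E} {K : NNReal} (hV : LipschitzWith K V)
    {α β : ℝ → E} (hα : ∀ t, HasDerivAt α (V (α t)) t) (hβ : ∀ t, HasDerivAt β (V (β t)) t)
    (t : ℝ) : dist (α t) (β t) ≤ dist (α 0) (β 0) * Real.exp (K * |t|) := by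
  rcases le_total 0 t with h | h
  · rw [abs_of_nonneg h]
    exact dist_le_of_hasDerivAt_of_nonneg hV hα hβ h
  · rw [abs_of_nonpos h]
    have hrev : ∀ {γ : ℝ → E}, (∀ t, HasDerivAt γ (V (γ t)) t) →
        ∀ t, HasDerivAt (fun s => γ (-s)) ((fun x => -V x) (γ (-t))) t := by
      intro γ hγ t
      simpa [Function.comp_def] using (hγ (-t)).scomp t (hasDerivAt_neg t)
    have := dist_le_of_hasDerivAt_of_nonneg hV.neg (hrev hα) (hrev hβ) (neg_nonneg.2 h)
    simpa using this

/-- A bounded Lipschitz vector field generates a global flow, which fixes its zeros. -/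
theorem exists_flow_of_lipschitz [CompleteSpace E] {V : E → E} {K C : NNReal}
    (hV : LipschitzWith K V) (hC : ∀ x, ‖V x‖ ≤ C) :
    ∃ φ : Flow ℝ E, (∀ x t, HasDerivAt (fun s => φ s x) (V (φ t x)) t) ∧
      ∀ x, V x = 0 → ∀ t, φ t x = x := by
  choose γ hγ0 hγ using exists_forall_hasDerivAt_of_lipschitz hV hC
  refine ⟨⟨fun t x => γ x t, ?_, ?_, hγ0⟩, hγ, fun x hx t => ?_⟩
  · rw [continuous_iff_continuousAt]
    rintro ⟨t₀, x₀⟩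
    rw [ContinuousAt, tendsto_iff_dist_tendsto_zero]
    have hbound : ∀ z : ℝ × E, dist (γ z.2 z.1) (γ x₀ t₀) ≤
        dist z.2 x₀ * Real.exp (K * |z.1|) + dist (γ x₀ z.1) (γ x₀ t₀) := by
      intro z
      refine (dist_triangle _ (γ x₀ z.1) _).trans ?_
      have := dist_le_of_hasDerivAt hV (hγ z.2) (hγ x₀) z.1
      rw [hγ0, hγ0] at this
      gcongr
    refine squeeze_zero (fun _ => dist_nonneg) hbound ?_
    have hcont : Continuous (γ x₀) :=
      continuous_iff_continuousAt.2 fun t => (hγ x₀ t).continuousAt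
    have : Continuous fun z : ℝ × E =>
        dist z.2 x₀ * Real.exp (K * |z.1|) + dist (γ x₀ z.1) (γ x₀ t₀) := by fun_prop
    simpa using this.tendsto (t₀, x₀)
  · intro s t x
    have h := ODE_solution_unique_univ (v := fun _ => V) (s := fun _ => univ) (K := K) (t₀ := 0)
      (f := fun s => γ x (s + t)) (g := γ (γ x t)) (fun _ => hV.lipschitzOnWith)
      (fun s => ⟨(hγ x (s + t)).comp_add_const s t, trivial⟩) (fun s => ⟨hγ _ s, trivial⟩)
      (by simp [hγ0])
    exact congrFun h s
  · have := dist_le_of_hasDerivAt hV (hγ x) (β := fun _ => x)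
      (fun s => by simpa [hx] using hasDerivAt_const s x) t
    simpa [hγ0] using this

/-- A compactly supported `C^1` vector field generates a global flow. -/
theorem exists_flow_of_hasCompactSupport [CompleteSpace E] {V : E → E} (hV : ContDiff ℝ 1 V)
    (hc : HasCompactSupport V) :
    ∃ φ : Flow ℝ E, (∀ x t, HasDerivAt (fun s => φ s x) (V (φ t x)) t) ∧
      ∀ x, V x = 0 → ∀ t, φ t x = x := by
  obtain ⟨K, hK⟩ := hV.lipschitzWith_of_hasCompactSupport hc one_ne_zero
  obtain ⟨C, hC⟩ := hc.exists_bound_of_continuous hV.continuous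
  exact exists_flow_of_lipschitz (C := ⟨max C 0, le_max_right _ _⟩) hK
    fun x => (hC x).trans (le_max_left _ _)

end FlowExistence

section FlowTopology

/-- If a function increases strictly from `a` to `b` along each orbit of a flow, then the space is
the product of a level set with the interval `(a, b)`. -/
theorem exists_homeomorph_levelSet_prod {U : Type*} [TopologicalSpace U] (φ : Flow ℝ U) {u : U → ℝ}
    (hu : Continuous u) {a b c : ℝ} (hc : c ∈ Ioo a b)
    (hmono : ∀ x, StrictMono fun t => u (φ t x))
    (hrange : ∀ x, range (fun t => u (φ t x)) = Ioo a b) :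
    ∃ e : U ≃ₜ {x // u x = c} × Ioo a b, ∀ x, ((e x).2 : ℝ) = u x := by
  have hmem : ∀ x, u x ∈ Ioo a b := fun x => by
    rw [← hrange x]
    exact ⟨0, by simp⟩
  have hex : ∀ z : U × Ioo a b, ∃ t, u (φ t z.1) = z.2 := fun z => (hrange z.1).ge z.2.2
  choose τ hτ using hex
  have hτc : Continuous τ := by
    rw [continuous_iff_continuousAt]
    intro z₀
    have hcont : ∀ r, Continuous fun z : U × Ioo a b => u (φ r z.1) := fun r =>
      hu.comp (φ.continuous continuous_const continuous_fst)
    have hcont' : Continuous fun z : U × Ioo a b => (z.2 : ℝ) := by fun_prop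
    refine tendsto_order.2 ⟨fun r hr => ?_, fun r hr => ?_⟩
    · have h : u (φ r z₀.1) < z₀.2 := by
        rw [← hτ z₀]
        exact hmono z₀.1 hr
      filter_upwards [(hcont r).continuousAt.eventually_lt hcont'.continuousAt h] with z hz
      rw [← hτ z] at hz
      exact (hmono z.1).lt_iff_lt.1 hz
    · have h : (z₀.2 : ℝ) < u (φ r z₀.1) := by
        rw [← hτ z₀]
        exact hmono z₀.1 hr
      filter_upwards [hcont'.continuousAt.eventually_lt (hcont r).continuousAt h] with z hz
      rw [← hτ z] at hz
      exact (hmono z.1).lt_iff_lt.1 hz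
  refine ⟨{ toFun := fun x => (⟨φ (τ (x, ⟨c, hc⟩)) x, hτ _⟩, ⟨u x, hmem x⟩)
            invFun := fun z => φ (τ (z.1, z.2)) z.1
            left_inv := fun x => ?_
            right_inv := fun z => ?_
            continuous_toFun := ?_
            continuous_invFun := ?_ }, fun x => rfl⟩
  · have h := hτ (φ (τ (x, ⟨c, hc⟩)) x, ⟨u x, hmem x⟩)
    dsimp only at h ⊢
    rw [← φ.map_add] at h ⊢
    have h0 := (hmono x).injective (a₂ := 0) (h.trans (by simp))
    rw [h0, φ.map_zero_apply]
  · obtain ⟨⟨x, hx⟩, ⟨s, hs⟩⟩ := z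
    have h := hτ (x, ⟨s, hs⟩)
    refine Prod.ext (Subtype.ext ?_) (Subtype.ext h)
    have h' := hτ (φ (τ (x, ⟨s, hs⟩)) x, ⟨c, hc⟩)
    dsimp only at h' ⊢
    rw [← φ.map_add] at h' ⊢
    have h0 := (hmono x).injective (a₂ := 0) (h'.trans (by simp [hx]))
    rw [h0, φ.map_zero_apply]
  · exact ((φ.continuous (hτc.comp (by fun_prop)) continuous_id).subtype_mk _).prodMk
      (hu.subtype_mk _)
  · exact φ.continuous (hτc.comp (by fun_prop)) (by fun_prop)

theorem isOpenMap_orbit {L : Type*} [TopologicalSpace L] (φ : Flow ℝ L)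
    (hloc : ∀ x, ∀ ε > 0, (fun t => φ t x) '' Ioo (-ε) ε ∈ 𝓝 x) (x : L) :
    IsOpenMap fun t => φ t x := by
  rw [isOpenMap_iff_nhds_le]
  intro t s hs
  obtain ⟨ε, hε, h⟩ := Metric.mem_nhds_iff.1 (mem_map.1 hs)
  filter_upwards [hloc (φ t x) ε hε]
  rintro _ ⟨r, hr, rfl⟩
  have : r + t ∈ Metric.ball t ε := by
    rw [Real.ball_eq_Ioo]
    exact ⟨by linarith [hr.1], by linarith [hr.2]⟩
  simpa [φ.map_add] using h this

/-- A compact connected Hausdorff space carrying a flow with open orbit maps and no global fixed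
point is a circle. -/
theorem nonempty_homeomorph_addCircle {L : Type*} [TopologicalSpace L] [CompactSpace L] [T2Space L]
    [ConnectedSpace L] (φ : Flow ℝ L) (hopen : ∀ x, IsOpenMap fun t => φ t x)
    (hfix : ∀ x, ∃ t, φ t x ≠ x) : Nonempty (L ≃ₜ AddCircle (1 : ℝ)) := by
  obtain ⟨x⟩ : Nonempty L := inferInstance
  have hcont : Continuous fun t => φ t x := φ.continuous continuous_id continuous_const
  have hsurj : Function.Surjective fun t => φ t x := by
    rw [← range_eq_univ]
    refine IsClopen.eq_univ ⟨⟨?_⟩, (hopen x).isOpen_range⟩ (range_nonempty _)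
    rw [isOpen_iff_mem_nhds]
    intro y hy
    filter_upwards [(hopen y).isOpen_range.mem_nhds ⟨0, by simp⟩]
    rintro _ ⟨t, rfl⟩ ⟨s, hs⟩
    refine hy ⟨-t + s, ?_⟩
    simp only at hs ⊢
    rw [φ.map_add, hs, ← φ.map_add, neg_add_cancel, φ.map_zero_apply]
  obtain ⟨n, hn⟩ : ∃ n : ℕ, univ ⊆ (fun t => φ t x) '' Ioo (-(n : ℝ)) n := by
    refine isCompact_univ.elim_directed_cover _ (fun n => hopen x _ isOpen_Ioo) ?_ ?_
    · intro y _
      obtain ⟨t, rfl⟩ := hsurj y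
      obtain ⟨n, hn⟩ := exists_nat_gt |t|
      exact mem_iUnion.2 ⟨n, t, abs_lt.1 hn, rfl⟩
    · refine directed_of_isDirected_le fun m n hmn => image_mono ?_
      have : (m : ℝ) ≤ n := by exact_mod_cast hmn
      exact Ioo_subset_Ioo (by linarith) this
  obtain ⟨s, hs, hsn⟩ := hn (mem_univ (φ n x))
  let S : AddSubgroup ℝ :=
    { carrier := {t | φ t x = x}
      zero_mem' := φ.map_zero_apply x
      add_mem' := fun {s t} hs ht => by
        simp only [mem_ofPred_eq] at hs ht ⊢
        rw [φ.map_add, ht, hs]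
      neg_mem' := fun {t} ht => by
        simp only [mem_ofPred_eq] at ht ⊢
        rw [← ht, ← φ.map_add, neg_add_cancel, φ.map_zero_apply, ht] }
  have hS : ∀ t, t ∈ S ↔ φ t x = x := fun t => Iff.rfl
  have hSclosed : IsClosed (S : Set ℝ) := isClosed_eq hcont continuous_const
  have hdiff : ∀ s t, φ s x = φ t x ↔ -s + t ∈ S := fun s t => by
    rw [hS, φ.map_add]
    constructor
    · intro h
      rw [← h, ← φ.map_add, neg_add_cancel, φ.map_zero_apply]
    · intro h
      conv_lhs => rw [← h]
      rw [← φ.map_add, add_neg_cancel, φ.map_zero_apply]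
  obtain ⟨T, hT⟩ : ∃ T, S = AddSubgroup.zmultiples T := by
    rcases S.dense_or_cyclic with h | ⟨T, hT⟩
    · obtain ⟨t, ht⟩ := hfix x
      have := h.closure_eq ▸ mem_univ t
      rw [hSclosed.closure_eq] at this
      exact absurd this ht
    · exact ⟨T, by rw [hT, AddSubgroup.zmultiples_eq_closure]⟩
  have hT0 : T ≠ 0 := by
    rintro rfl
    have h := (hdiff s n).1 hsn
    rw [hT, AddSubgroup.zmultiples_zero_eq_bot, AddSubgroup.mem_bot] at h
    linarith [hs.2]
  let F : AddCircle T → L := Quotient.lift (fun t => φ t x) fun s t hst => by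
    rw [hdiff, hT]
    exact QuotientAddGroup.leftRel_apply.1 hst
  have hF : ∀ t : ℝ, F (t : AddCircle T) = φ t x := fun t => rfl
  have hFbij : Function.Bijective F := by
    constructor
    · intro y z h
      induction y using QuotientAddGroup.induction_on with | H s => ?_
      induction z using QuotientAddGroup.induction_on with | H t => ?_
      have h' : φ s x = φ t x := h
      rw [hdiff, hT] at h'
      exact QuotientAddGroup.eq.2 h'
    · intro y
      obtain ⟨t, rfl⟩ := hsurj y
      exact ⟨t, rfl⟩
  have hFcont : Continuous F := hcont.quotient_lift _
  have hFopen : IsOpenMap F := by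
    intro W hW
    have : F '' W = (fun t => φ t x) '' ((fun t : ℝ => (t : AddCircle T)) ⁻¹' W) := by
      ext y
      constructor
      · rintro ⟨z, hz, rfl⟩
        induction z using QuotientAddGroup.induction_on with | H t => exact ⟨t, hz, rfl⟩
      · rintro ⟨t, ht, rfl⟩
        exact ⟨t, ht, rfl⟩
    rw [this]
    exact hopen x _ (hW.preimage (AddCircle.continuous_mk' T))
  exact ⟨((Equiv.ofBijective F hFbij).toHomeomorphOfContinuousOpen hFcont hFopen).symm.trans
    (AddCircle.homeomorphAddCircle T 1 hT0 one_ne_zero)⟩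

end FlowTopology

section PoleExtension

open Classical in
/-- Extend a map between complements of two points by prescribing its values at these points. -/
noncomputable def extendTwoPoints {X Y : Type*} (p q : X) (p' q' : Y)
    (e : {x // x ≠ p ∧ x ≠ q} → {y // y ≠ p' ∧ y ≠ q'}) (x : X) : Y :=
  if h : x ≠ p ∧ x ≠ q then e ⟨x, h⟩ else if x = p then p' else q'

theorem extendTwoPoints_apply_of_ne {X Y : Type*} {p q : X} {p' q' : Y}
    (e : {x // x ≠ p ∧ x ≠ q} → {y // y ≠ p' ∧ y ≠ q'}) (x : {x // x ≠ p ∧ x ≠ q}) :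
    extendTwoPoints p q p' q' e x = e x := by
  simp [extendTwoPoints, x.2.1, x.2.2]

theorem extendTwoPoints_apply_left {X Y : Type*} {p q : X} {p' q' : Y}
    (e : {x // x ≠ p ∧ x ≠ q} → {y // y ≠ p' ∧ y ≠ q'}) :
    extendTwoPoints p q p' q' e p = p' := by
  simp [extendTwoPoints]

theorem extendTwoPoints_apply_right {X Y : Type*} {p q : X} {p' q' : Y} (hpq : p ≠ q)
    (e : {x // x ≠ p ∧ x ≠ q} → {y // y ≠ p' ∧ y ≠ q'}) :
    extendTwoPoints p q p' q' e q = q' := by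
  simp [extendTwoPoints, hpq.symm]

theorem extendTwoPoints_leftInverse {X Y : Type*} {p q : X} {p' q' : Y} (hpq : p ≠ q)
    (hpq' : p' ≠ q') (e : {x // x ≠ p ∧ x ≠ q} ≃ {y // y ≠ p' ∧ y ≠ q'}) :
    Function.LeftInverse (extendTwoPoints p' q' p q e.symm) (extendTwoPoints p q p' q' e) := by
  intro x
  by_cases hp : x = p
  · rw [hp, extendTwoPoints_apply_left, extendTwoPoints_apply_left]
  by_cases hq : x = q
  · rw [hq, extendTwoPoints_apply_right hpq, extendTwoPoints_apply_right hpq']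
  have := extendTwoPoints_apply_of_ne e ⟨x, hp, hq⟩
  rw [this, extendTwoPoints_apply_of_ne, e.symm_apply_apply]

theorem extendTwoPoints_comp_eq {X Y : Type*} {p q : X} {p' q' : Y} (hpq : p ≠ q)
    {e : {x // x ≠ p ∧ x ≠ q} → {y // y ≠ p' ∧ y ≠ q'}} {u : X → ℝ} {v : Y → ℝ} {θ : ℝ → ℝ}
    (hp : v p' = θ (u p)) (hq : v q' = θ (u q)) (he : ∀ x, v (e x) = θ (u x)) (x : X) :
    v (extendTwoPoints p q p' q' e x) = θ (u x) := by
  by_cases hxp : x = p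
  · rw [hxp, extendTwoPoints_apply_left, hp]
  by_cases hxq : x = q
  · rw [hxq, extendTwoPoints_apply_right hpq, hq]
  have := extendTwoPoints_apply_of_ne e ⟨x, hxp, hxq⟩
  rw [this, he]

/-- In a compact space, convergence to a point where a continuous function takes a value taken
nowhere else is detected by that function. -/
theorem tendsto_nhds_of_comp_of_unique {α Y : Type*} [TopologicalSpace Y] [CompactSpace Y]
    {v : Y → ℝ} (hv : Continuous v) {y : Y} (hy : ∀ z, v z = v y → z = y) {l : Filter α} {h : α → Y}
    (hl : Tendsto (fun x => v (h x)) l (𝓝 (v y))) : Tendsto h l (𝓝 y) := by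
  refine isCompact_univ.le_nhds_of_unique_clusterPt (by simp) fun z _ hz => hy z ?_
  have h1 : ClusterPt (v z) (map v (map h l)) := hz.map hv.continuousAt tendsto_map
  exact eq_of_nhds_neBot (h1.mono (show map v (map h l) ≤ 𝓝 (v y) from hl))

theorem continuous_extendTwoPoints {X Y : Type*} [TopologicalSpace X] [T1Space X]
    [TopologicalSpace Y] [CompactSpace Y] {p q : X} {p' q' : Y} (hpq : p ≠ q)
    {e : {x // x ≠ p ∧ x ≠ q} → {y // y ≠ p' ∧ y ≠ q'}} (hec : Continuous e)
    {u : X → ℝ} (hu : Continuous u) {v : Y → ℝ} (hv : Continuous v) {θ : ℝ → ℝ} (hθ : Continuous θ)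
    (hp : v p' = θ (u p)) (hq : v q' = θ (u q)) (he : ∀ x, v (e x) = θ (u x))
    (hp' : ∀ y, v y = v p' → y = p') (hq' : ∀ y, v y = v q' → y = q') :
    Continuous (extendTwoPoints p q p' q' e) := by
  have hcomp : ∀ x, Tendsto (fun z => v (extendTwoPoints p q p' q' e z)) (𝓝 x) (𝓝 (θ (u x))) := by
    simp_rw [extendTwoPoints_comp_eq hpq hp hq he]
    exact fun x => (hθ.comp hu).tendsto x
  rw [continuous_iff_continuousAt]
  intro x
  by_cases hxp : x = p
  · subst hxp
    rw [ContinuousAt, extendTwoPoints_apply_left]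
    exact tendsto_nhds_of_comp_of_unique hv hp' (hp ▸ hcomp x)
  by_cases hxq : x = q
  · subst hxq
    rw [ContinuousAt, extendTwoPoints_apply_right hpq]
    exact tendsto_nhds_of_comp_of_unique hv hq' (hq ▸ hcomp x)
  have hopen : IsOpen {x | x ≠ p ∧ x ≠ q} := isOpen_ne.inter isOpen_ne
  refine ContinuousOn.continuousAt (s := {x | x ≠ p ∧ x ≠ q}) ?_ (hopen.mem_nhds ⟨hxp, hxq⟩)
  rw [continuousOn_iff_continuous_domRestrict]
  have : domRestrict {x | x ≠ p ∧ x ≠ q} (extendTwoPoints p q p' q' e) = fun x => (e x : Y) :=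
    funext fun x => extendTwoPoints_apply_of_ne e x
  rw [this]
  exact continuous_subtype_val.comp hec

end PoleExtension

section RealLemmas

/-- A function whose derivative is nonnegative, and bounded below as long as the function stays in
a compact subinterval of `(m, M)`, takes all values in `(m, M)`. -/
theorem exists_eq_of_hasDerivAt {w w' : ℝ → ℝ} {m M : ℝ} (hw : ∀ t, HasDerivAt w (w' t) t)
    (h0 : ∀ t, 0 ≤ w' t) (hmem : ∀ t, w t ∈ Ioo m M)
    (hδ : ∀ a b, m < a → b < M → ∃ δ > 0, ∀ t, w t ∈ Icc a b → δ ≤ w' t)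
    {c : ℝ} (hc : c ∈ Ioo m M) : ∃ t, w t = c := by
  have hdiff : Differentiable ℝ w := fun t => (hw t).differentiableAt
  have hmono : Monotone w := monotone_of_deriv_nonneg hdiff fun t => by
    rw [(hw t).deriv]
    exact h0 t
  refine mem_range_of_exists_le_of_exists_ge hdiff.continuous ?_ ?_
  · by_contra! hcon
    obtain ⟨δ, hδ0, hδ⟩ := hδ c (w 0) hc.1 (hmem 0).2
    have h := (convex_Iic (0 : ℝ)).mul_sub_le_image_sub_of_le_deriv hdiff.continuous.continuousOn
      hdiff.differentiableOn (C := δ) (fun t ht => by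
        rw [(hw t).deriv]
        exact hδ t ⟨(hcon t).le, hmono (mem_Iic.1 (interior_subset ht))⟩)
    have hneg : -((w 0 - c) / δ) ≤ 0 := neg_nonpos.2 (div_nonneg (by linarith [hcon 0]) hδ0.le)
    have h1 := h _ hneg 0 self_mem_Iic hneg
    have h2 : δ * (0 - -((w 0 - c) / δ)) = w 0 - c := by field_simp; ring
    linarith [hcon (-((w 0 - c) / δ))]
  · by_contra! hcon
    obtain ⟨δ, hδ0, hδ⟩ := hδ (w 0) c (hmem 0).1 hc.2
    have h := (convex_Ici (0 : ℝ)).mul_sub_le_image_sub_of_le_deriv hdiff.continuous.continuousOn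
      hdiff.differentiableOn (C := δ) (fun t ht => by
        rw [(hw t).deriv]
        exact hδ t ⟨hmono (mem_Ici.1 (interior_subset ht)), (hcon t).le⟩)
    have hpos : 0 ≤ (c - w 0) / δ := div_nonneg (by linarith [hcon 0]) hδ0.le
    have h1 := h 0 self_mem_Ici _ hpos hpos
    have h2 : δ * ((c - w 0) / δ - 0) = c - w 0 := by field_simp; ring
    linarith [hcon ((c - w 0) / δ)]

/-- A function with positive derivative at `0` crosses its value there from below. -/
theorem eventually_lt_and_lt_of_hasDerivAt_pos {ℓ : ℝ → ℝ} {d : ℝ} (h : HasDerivAt ℓ d 0)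
    (hd : 0 < d) : ∀ᶠ r in 𝓝[>] (0 : ℝ), ℓ (-r) < ℓ 0 ∧ ℓ 0 < ℓ r := by
  have hslope := (hasDerivAt_iff_tendsto_slope.1 h).eventually_const_lt hd
  have hpos : ∀ᶠ r in 𝓝[>] (0 : ℝ), 0 < slope ℓ 0 r :=
    hslope.filter_mono (nhdsWithin_mono _ fun r (hr : 0 < r) => hr.ne')
  have hneg : ∀ᶠ r in 𝓝[>] (0 : ℝ), 0 < slope ℓ 0 (-r) := by
    have : Tendsto (fun r : ℝ => -r) (𝓝[>] 0) (𝓝[≠] 0) := by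
      refine tendsto_nhdsWithin_iff.2 ⟨?_, ?_⟩
      · exact (Continuous.tendsto' continuous_neg 0 0 neg_zero).mono_left nhdsWithin_le_nhds
      · filter_upwards [self_mem_nhdsWithin] with r hr
        exact neg_ne_zero.2 (ne_of_gt hr)
    exact this.eventually hslope
  filter_upwards [hpos, hneg, self_mem_nhdsWithin] with r h1 h2 hr
  have hr : 0 < r := hr
  simp only [slope_def_field, sub_zero] at h1 h2
  rw [div_pos_iff_of_pos_right hr] at h1
  rw [div_neg, ← neg_div, div_pos_iff_of_pos_right hr] at h2
  constructor <;> linarith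

end RealLemmas

section CrossProduct

/-- Three-dimensional Euclidean space. -/
abbrev Space3 : Type := EuclideanSpace ℝ (Fin 3)

/-- The cross product on Euclidean three-space. -/
def cross3 (a b : Space3) : Space3 :=
  !₂[a 1 * b 2 - a 2 * b 1, a 2 * b 0 - a 0 * b 2, a 0 * b 1 - a 1 * b 0]

theorem inner_space3 (a b : Space3) : inner ℝ a b = a 0 * b 0 + a 1 * b 1 + a 2 * b 2 := by
  simp [PiLp.inner_apply, Fin.sum_univ_three]
  ring

theorem inner_self_cross3 (a b : Space3) : inner ℝ a (cross3 a b) = 0 := by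
  simp [inner_space3, cross3]
  ring

theorem inner_cross3_self (a b : Space3) : inner ℝ b (cross3 a b) = 0 := by
  simp [inner_space3, cross3]
  ring

theorem inner_cross3_cross3_self (a b : Space3) :
    inner ℝ b (cross3 (cross3 a b) a) = ‖cross3 a b‖ ^ 2 := by
  rw [← real_inner_self_eq_norm_sq]
  simp only [inner_space3]
  simp [cross3]
  ring

theorem cross3_cross3_self (a b : Space3) :
    cross3 (cross3 a b) a = (inner ℝ a a : ℝ) • b - (inner ℝ a b : ℝ) • a := by
  simp only [inner_space3]
  ext i
  fin_cases i <;> simp [cross3] <;> ring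

@[simp]
theorem cross3_zero_left (b : Space3) : cross3 0 b = 0 := by
  ext i
  fin_cases i <;> simp [cross3]

@[simp]
theorem cross3_zero_right (a : Space3) : cross3 a 0 = 0 := by
  ext i
  fin_cases i <;> simp [cross3]

/-- If `a × b ≠ 0`, then only the zero vector is orthogonal to `a`, `b` and `a × b`. -/
theorem eq_zero_of_inner_cross3_eq_zero {a b y : Space3} (hab : cross3 a b ≠ 0)
    (ha : inner ℝ a y = (0 : ℝ)) (hb : inner ℝ b y = (0 : ℝ))
    (hc : inner ℝ (cross3 a b) y = (0 : ℝ)) : y = 0 := by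
  have h : ‖cross3 a b‖ ^ 2 * ‖y‖ ^ 2 = (inner ℝ (cross3 a b) y : ℝ) ^ 2
      + ‖(inner ℝ b y : ℝ) • a - (inner ℝ a y : ℝ) • b‖ ^ 2 := by
    simp only [← real_inner_self_eq_norm_sq]
    simp only [inner_space3]
    simp [cross3]
    ring
  rw [ha, hb, hc] at h
  simpa [hab] using h

theorem ContDiff.cross3 {G : Type*} [NormedAddCommGroup G] [NormedSpace ℝ G] {n : WithTop ℕ∞}
    {a b : G → Space3} (ha : ContDiff ℝ n a) (hb : ContDiff ℝ n b) :
    ContDiff ℝ n fun x => _root_.cross3 (a x) (b x) := by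
  rw [contDiff_euclidean] at ha hb ⊢
  have h := fun i j => (ha i).mul (hb j)
  intro i
  fin_cases i
  · exact (h 1 2).sub (h 2 1)
  · exact (h 2 0).sub (h 0 2)
  · exact (h 0 1).sub (h 1 0)

end CrossProduct

section RotatedGradient

/-- The vector field `x ↦ x × ∇F x`, tangent both to the spheres centred at the origin and to the
level sets of `F`. -/
noncomputable def rotGrad (F : Space3 → ℝ) (x : Space3) : Space3 := cross3 x (gradient F x)

/-- The vector field `x ↦ (x × ∇F x) × x`, which on the unit sphere is the tangential part of the
gradient of `F`. -/
noncomputable def tangGrad (F : Space3 → ℝ) (x : Space3) : Space3 := cross3 (rotGrad F x) x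

variable {F : Space3 → ℝ}

theorem contDiff_gradient (hF : ContDiff ℝ 2 F) : ContDiff ℝ 1 (gradient F) :=
  (InnerProductSpace.toDual ℝ Space3).symm.toContinuousLinearEquiv.contDiff.comp
    (hF.fderiv_right (m := 1) le_rfl)

theorem contDiff_rotGrad (hF : ContDiff ℝ 2 F) : ContDiff ℝ 1 (rotGrad F) :=
  contDiff_id.cross3 (contDiff_gradient hF)

theorem contDiff_tangGrad (hF : ContDiff ℝ 2 F) : ContDiff ℝ 1 (tangGrad F) :=
  (contDiff_rotGrad hF).cross3 contDiff_id

theorem hasCompactSupport_gradient (hc : HasCompactSupport F) : HasCompactSupport (gradient F) :=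
  (hc.fderiv ℝ).comp_left (map_zero _)

theorem hasCompactSupport_rotGrad (hc : HasCompactSupport F) : HasCompactSupport (rotGrad F) :=
  (hasCompactSupport_gradient hc).mono fun x hx h0 => hx (by simp [rotGrad, h0])

theorem hasCompactSupport_tangGrad (hc : HasCompactSupport F) : HasCompactSupport (tangGrad F) :=
  (hasCompactSupport_rotGrad hc).mono fun x hx h0 => hx (by simp [tangGrad, h0])

theorem inner_self_rotGrad (x : Space3) : inner ℝ x (rotGrad F x) = (0 : ℝ) :=
  inner_self_cross3 _ _

theorem inner_self_tangGrad (x : Space3) : inner ℝ x (tangGrad F x) = (0 : ℝ) :=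
  inner_cross3_self _ _

theorem inner_gradient_rotGrad (x : Space3) : inner ℝ (gradient F x) (rotGrad F x) = (0 : ℝ) :=
  inner_cross3_self _ _

theorem inner_gradient_tangGrad (x : Space3) :
    inner ℝ (gradient F x) (tangGrad F x) = ‖rotGrad F x‖ ^ 2 :=
  inner_cross3_cross3_self _ _

theorem inner_gradient_eq_fderiv (x v : Space3) : inner ℝ (gradient F x) v = fderiv ℝ F x v :=
  InnerProductSpace.toDual_symm_apply

theorem hasDerivAt_comp_curve (hF : ContDiff ℝ 2 F) {γ : ℝ → Space3} {v : Space3} {t : ℝ}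
    (hγ : HasDerivAt γ v t) :
    HasDerivAt (fun s => F (γ s)) (inner ℝ (gradient F (γ t)) v) t := by
  rw [inner_gradient_eq_fderiv]
  exact ((hF.differentiable two_ne_zero) (γ t)).hasFDerivAt.comp_hasDerivAt t hγ

/-- The flow of a vector field orthogonal to the position vector preserves the unit sphere. -/
theorem isInvariant_sphere {V : Space3 → Space3} (hV : ∀ x, inner ℝ x (V x) = (0 : ℝ))
    {φ : Flow ℝ Space3} (hφ : ∀ x t, HasDerivAt (fun s => φ s x) (V (φ t x)) t) :
    IsInvariant φ (Metric.sphere (0 : Space3) 1) := by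
  intro t x hx
  have h : ∀ t, HasDerivAt (fun s => ‖φ s x‖ ^ 2) 0 t := fun t => by
    simpa [hV] using (hφ x t).norm_sq
  have h1 := is_const_of_deriv_eq_zero (fun t => (h t).differentiableAt) (fun t => (h t).deriv) t 0
  rw [mem_sphere_zero_iff_norm] at hx ⊢
  simp only [φ.map_zero_apply, hx] at h1
  exact (sq_eq_sq₀ (norm_nonneg _) zero_le_one).1 h1

/-- Near a point where `x × ∇F x` does not vanish, a point of the sphere is determined by the value
of `F` and by its component along that vector. -/
theorem exists_nhds_eq_of_eq (hF : ContDiff ℝ 2 F) {x : Space3} (hx : rotGrad F x ≠ 0) :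
    ∃ N ∈ 𝓝 x, ∀ y ∈ N, ∀ z ∈ N, ‖y‖ = ‖z‖ → F y = F z →
      inner ℝ (rotGrad F x) y = (inner ℝ (rotGrad F x) z : ℝ) → y = z := by
  set w := rotGrad F x with hw
  set G := gradient F x with hG
  let P : Space3 → Space3 := fun y => (‖y‖ ^ 2) • x + F y • G + (inner ℝ w y : ℝ) • w
  let P' : Space3 →L[ℝ] Space3 :=
    ((2 : ℝ) • innerSL ℝ x).smulRight x + (fderiv ℝ F x).smulRight G + (innerSL ℝ w).smulRight w
  have hP : HasStrictFDerivAt P P' x := by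
    have h1 : HasStrictFDerivAt (fun y : Space3 => ‖y‖ ^ 2) ((2 : ℝ) • innerSL ℝ x) x := by
      rw [two_smul, ← two_nsmul]
      exact hasStrictFDerivAt_norm_sq x
    have h2 : HasStrictFDerivAt F (fderiv ℝ F x) x :=
      hF.contDiffAt.hasStrictFDerivAt two_ne_zero
    have h3 : HasStrictFDerivAt (fun y : Space3 => (inner ℝ w y : ℝ)) (innerSL ℝ w) x :=
      (innerSL ℝ w).hasStrictFDerivAt
    exact ((h1.smul_const x).add (h2.smul_const G)).add (h3.smul_const w)
  have hinj : Function.Injective P' := by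
    rw [injective_iff_map_eq_zero]
    intro v hv
    have h : 2 * (inner ℝ x v : ℝ) ^ 2 + (inner ℝ G v : ℝ) ^ 2 + (inner ℝ w v : ℝ) ^ 2 = 0 := by
      have h0 : inner ℝ (P' v) v = (0 : ℝ) := by rw [hv, inner_zero_left]
      simp only [P', add_apply, ContinuousLinearMap.smulRight_apply,
        smul_apply, innerSL_apply_apply, inner_add_left, real_inner_smul_left,
        ← inner_gradient_eq_fderiv, smul_eq_mul, ← hG] at h0
      linarith
    have hx0 : (inner ℝ x v : ℝ) = 0 := by
      rw [← sq_eq_zero_iff]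
      linarith [sq_nonneg (inner ℝ x v : ℝ), sq_nonneg (inner ℝ G v : ℝ),
        sq_nonneg (inner ℝ w v : ℝ)]
    have hG0 : (inner ℝ G v : ℝ) = 0 := by
      rw [← sq_eq_zero_iff]
      linarith [sq_nonneg (inner ℝ x v : ℝ), sq_nonneg (inner ℝ G v : ℝ),
        sq_nonneg (inner ℝ w v : ℝ)]
    have hw0 : (inner ℝ w v : ℝ) = 0 := by
      rw [← sq_eq_zero_iff]
      linarith [sq_nonneg (inner ℝ x v : ℝ), sq_nonneg (inner ℝ G v : ℝ),
        sq_nonneg (inner ℝ w v : ℝ)]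
    exact eq_zero_of_inner_cross3_eq_zero hx hx0 hG0 hw0
  let e : Space3 ≃L[ℝ] Space3 :=
    (LinearEquiv.ofInjectiveEndo (P' : Space3 →ₗ[ℝ] Space3) hinj).toContinuousLinearEquiv
  have he : (e : Space3 →L[ℝ] Space3) = P' := by
    ext1 v
    rfl
  have hPe : HasStrictFDerivAt P (e : Space3 →L[ℝ] Space3) x := by rwa [he]
  refine ⟨(hPe.toOpenPartialHomeomorph P).source,
    (hPe.toOpenPartialHomeomorph P).open_source.mem_nhds hPe.mem_toOpenPartialHomeomorph_source,
    fun y hy z hz h1 h2 h3 => (hPe.toOpenPartialHomeomorph P).injOn hy hz ?_⟩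
  change P y = P z
  simp only [P, h1, h2, h3]

/-- Near `x`, the level curve of `F` through `x` is swept out by the flow of `rotGrad F`. -/
theorem exists_nhds_forall_exists_flow_eq (hF : ContDiff ℝ 2 F) {ψ : Flow ℝ Space3}
    (hψ : ∀ x t, HasDerivAt (fun s => ψ s x) (rotGrad F (ψ t x)) t)
    (hψF : ∀ x t, F (ψ t x) = F x) {x : Space3} (hxS : x ∈ Metric.sphere (0 : Space3) 1)
    (hx : rotGrad F x ≠ 0) {ε : ℝ} (hε : 0 < ε) :
    ∃ N ∈ 𝓝 x, ∀ y ∈ N, y ∈ Metric.sphere (0 : Space3) 1 → F y = F x →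
      ∃ t ∈ Ioo (-ε) ε, ψ t x = y := by
  obtain ⟨N, hN, hinj⟩ := exists_nhds_eq_of_eq hF hx
  have hcont : Continuous fun t => ψ t x := ψ.continuous continuous_id continuous_const
  set ℓ : ℝ → ℝ := fun t => inner ℝ (rotGrad F x) (ψ t x) with hℓ
  have hℓc : Continuous ℓ := continuous_const.inner hcont
  have hℓd : HasDerivAt ℓ (‖rotGrad F x‖ ^ 2) 0 := by
    have h := (innerSL ℝ (rotGrad F x)).hasFDerivAt.comp_hasDerivAt (0 : ℝ) (hψ x 0)
    rw [ψ.map_zero_apply, innerSL_apply_apply, real_inner_self_eq_norm_sq] at h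
    exact h
  have hpos : 0 < ‖rotGrad F x‖ ^ 2 := by positivity
  have hNt : ∀ᶠ t in 𝓝 (0 : ℝ), ψ t x ∈ N :=
    hcont.continuousAt.eventually_mem (by simpa using hN)
  obtain ⟨ρ, hρ, hρN⟩ := Metric.eventually_nhds_iff_ball.1 hNt
  have hsmall : ∀ᶠ r in 𝓝[>] (0 : ℝ), r < min ε ρ :=
    (eventually_lt_nhds (lt_min hε hρ)).filter_mono nhdsWithin_le_nhds
  obtain ⟨r, ⟨⟨hr1, hr2⟩, hr3⟩, hr0⟩ :=
    (((eventually_lt_and_lt_of_hasDerivAt_pos hℓd hpos).and hsmall).and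
      self_mem_nhdsWithin).exists
  have hr0 : 0 < r := hr0
  have hℓ0 : ℓ 0 = inner ℝ (rotGrad F x) x := by simp [hℓ]
  refine ⟨N ∩ (fun y => (inner ℝ (rotGrad F x) y : ℝ)) ⁻¹' Ioo (ℓ (-r)) (ℓ r), ?_, ?_⟩
  · refine inter_mem hN (ContinuousAt.preimage_mem_nhds
      (continuous_const.inner continuous_id).continuousAt ?_)
    simp only [← hℓ0]
    exact Ioo_mem_nhds hr1 hr2
  · rintro y ⟨hyN, hyI⟩ hyS hyF
    obtain ⟨t, ht, hty⟩ := intermediate_value_Icc (by linarith : -r ≤ r) hℓc.continuousOn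
      (Ioo_subset_Icc_self hyI)
    have htr : |t| < min ε ρ := (abs_le.2 ht).trans_lt hr3
    refine ⟨t, abs_lt.1 (htr.trans_le (min_le_left _ _)), ?_⟩
    refine hinj _ (hρN t ?_) _ hyN ?_ (by rw [hψF, hyF]) hty
    · simpa using htr.trans_le (min_le_right _ _)
    · have := isInvariant_sphere inner_self_rotGrad hψ t hxS
      rw [mem_sphere_zero_iff_norm] at this hyS
      rw [this, hyS]

end RotatedGradient

section Assembly

/-- A function on a compact space with a unique maximum and a unique minimum, increasing along a
flow between them and invariant under another flow which is locally transitive on its level sets,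
looks like the projection of an open cylinder away from its extrema. -/
theorem exists_homeomorph_addCircle_prod {X : Type*} [TopologicalSpace X] [CompactSpace X]
    [T2Space X] {u : X → ℝ} (hu : Continuous u) {p q : X} (hlt : u q < u p)
    (hmem : ∀ x, x ≠ p → x ≠ q → u x ∈ Ioo (u q) (u p)) [ConnectedSpace {x // x ≠ p ∧ x ≠ q}]
    {φ ψ : Flow ℝ X} (hφp : ∀ t, φ t p = p) (hφq : ∀ t, φ t q = q)
    (hmono : ∀ x, x ≠ p → x ≠ q → StrictMono fun t => u (φ t x))
    (hrange : ∀ x, x ≠ p → x ≠ q → ∀ c ∈ Ioo (u q) (u p), ∃ t, u (φ t x) = c)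
    (hψ : ∀ t x, u (ψ t x) = u x) (hfix : ∀ x, x ≠ p → x ≠ q → ∃ t, ψ t x ≠ x)
    (hloc : ∀ x, x ≠ p → x ≠ q → ∀ ε > 0, ∃ N ∈ 𝓝 x, ∀ y ∈ N, u y = u x →
      ∃ t ∈ Ioo (-ε) ε, ψ t x = y) :
    ∃ e : {x // x ≠ p ∧ x ≠ q} ≃ₜ AddCircle (1 : ℝ) × Ioo (u q) (u p),
      ∀ x, ((e x).2 : ℝ) = u x := by
  have hinv : IsInvariant φ {x | x ≠ p ∧ x ≠ q} := by
    have h : ∀ t x y, (∀ s, φ s y = y) → φ t x = y → x = y := fun t x y hy hxy => by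
      rw [← hy (-t), ← hxy, ← φ.map_add, neg_add_cancel, φ.map_zero_apply]
    exact fun t x hx => ⟨fun h0 => hx.1 (h t x p hφp h0), fun h0 => hx.2 (h t x q hφq h0)⟩
  let φU : Flow ℝ {x // x ≠ p ∧ x ≠ q} := φ.restrict hinv
  obtain ⟨c, hc⟩ := exists_between hlt
  obtain ⟨e, he⟩ := exists_homeomorph_levelSet_prod φU (u := fun x => u x)
    (hu.comp continuous_subtype_val) (a := u q) (b := u p) (c := c) hc
    (fun x => hmono x x.2.1 x.2.2) fun x => by
      refine Subset.antisymm ?_ fun d hd => hrange x x.2.1 x.2.2 d hd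
      rintro _ ⟨t, rfl⟩
      exact hmem _ (φU t x).2.1 (φU t x).2.2
  let L : Set X := {x | u x = c}
  have hLne : ∀ x : L, (x : X) ≠ p ∧ (x : X) ≠ q := by
    intro x
    have hx : u x = c := x.2
    exact ⟨fun h => hc.2.ne (by rw [← hx, h]), fun h => hc.1.ne (by rw [← hx, h])⟩
  let ι : {x : {x // x ≠ p ∧ x ≠ q} // u x = c} ≃ₜ L :=
    { toFun := fun x => ⟨x.1.1, x.2⟩
      invFun := fun x => ⟨⟨x.1, hLne x⟩, x.2⟩
      left_inv := fun _ => rfl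
      right_inv := fun _ => rfl
      continuous_toFun := by fun_prop
      continuous_invFun := by fun_prop }
  have : CompactSpace L :=
    isCompact_iff_compactSpace.1 (isClosed_eq hu continuous_const).isCompact
  have : ConnectedSpace L := by
    have hsurj : Function.Surjective fun x => ι (e x).1 := fun l =>
      ⟨e.symm (ι.symm l, ⟨c, hc⟩), by simp⟩
    exact hsurj.connectedSpace (by fun_prop)
  let ψL : Flow ℝ L := ψ.restrict fun t x (hx : u x = c) => (hψ t x).trans hx
  obtain ⟨k⟩ := nonempty_homeomorph_addCircle ψL (fun x => isOpenMap_orbit ψL (fun x ε hε => by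
      obtain ⟨N, hN, h⟩ := hloc x (hLne x).1 (hLne x).2 ε hε
      filter_upwards [continuous_subtype_val.continuousAt.preimage_mem_nhds hN] with y hy
      obtain ⟨t, ht, hty⟩ := h y hy (y.2.trans x.2.symm)
      exact ⟨t, ht, Subtype.ext hty⟩) x) fun x => by
      obtain ⟨t, ht⟩ := hfix x (hLne x).1 (hLne x).2
      exact ⟨t, fun h => ht (congrArg Subtype.val h)⟩
  exact ⟨e.trans ((ι.trans k).prodCongr (Homeomorph.refl _)), he⟩

/-- Two functions on compact spaces which look like the projection of an open cylinder away from
their unique extrema are topologically conjugate. -/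
theorem exists_conjugation {X Y A : Type*} [TopologicalSpace X] [CompactSpace X] [T2Space X]
    [TopologicalSpace Y] [CompactSpace Y] [T2Space Y] [TopologicalSpace A]
    {u : X → ℝ} (hu : Continuous u) {v : Y → ℝ} (hv : Continuous v) {p q : X} {p' q' : Y}
    (hlt : u q < u p) (hlt' : v q' < v p')
    (hmem : ∀ x, x ≠ p → x ≠ q → u x ∈ Ioo (u q) (u p))
    (hmem' : ∀ y, y ≠ p' → y ≠ q' → v y ∈ Ioo (v q') (v p'))
    (e : {x // x ≠ p ∧ x ≠ q} ≃ₜ A × Ioo (u q) (u p)) (he : ∀ x, ((e x).2 : ℝ) = u x)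
    (e' : {y // y ≠ p' ∧ y ≠ q'} ≃ₜ A × Ioo (v q') (v p')) (he' : ∀ y, ((e' y).2 : ℝ) = v y) :
    ∃ (h : X ≃ₜ Y) (θ : ℝ ≃ₜ ℝ), StrictMono θ ∧ ∀ x, v (h x) = θ (u x) := by
  have huniq : ∀ x, (u x = u p → x = p) ∧ (u x = u q → x = q) := fun x => by
    by_cases hxp : x = p
    · subst hxp
      exact ⟨fun _ => rfl, fun h => absurd h hlt.ne'⟩
    by_cases hxq : x = q
    · subst hxq
      exact ⟨fun h => absurd h hlt.ne, fun _ => rfl⟩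
    have h := hmem x hxp hxq
    exact ⟨fun h0 => absurd h0 h.2.ne, fun h0 => absurd h0 h.1.ne'⟩
  have huniq' : ∀ y, (v y = v p' → y = p') ∧ (v y = v q' → y = q') := fun x => by
    by_cases hxp : x = p'
    · subst hxp
      exact ⟨fun _ => rfl, fun h => absurd h hlt'.ne'⟩
    by_cases hxq : x = q'
    · subst hxq
      exact ⟨fun h => absurd h hlt'.ne, fun _ => rfl⟩
    have h := hmem' x hxp hxq
    exact ⟨fun h0 => absurd h0 h.2.ne, fun h0 => absurd h0 h.1.ne'⟩
  have hpq : p ≠ q := fun h => hlt.ne (by rw [h])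
  have hpq' : p' ≠ q' := fun h => hlt'.ne (by rw [h])
  set k := (v p' - v q') / (u p - u q) with hk
  have hk0 : 0 < k := div_pos (by linarith) (by linarith)
  let θ : ℝ ≃ₜ ℝ := affineHomeomorph k (v q' - k * u q) hk0.ne'
  have hθ : ∀ x, θ x = k * x + (v q' - k * u q) := fun x => rfl
  have hmonoθ : StrictMono θ := fun x y hxy => by
    rw [hθ, hθ]
    linarith [mul_lt_mul_of_pos_left hxy hk0]
  have hq : v q' = θ (u q) := by rw [hθ]; ring
  have hp : v p' = θ (u p) := by
    have : u p - u q ≠ 0 := by linarith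
    rw [hθ, hk]
    field_simp
    ring
  let θI : Ioo (u q) (u p) ≃ₜ Ioo (v q') (v p') := θ.subtype fun x => by
    rw [hp, hq]
    simp only [mem_Ioo, hmonoθ.lt_iff_lt]
  let E : {x // x ≠ p ∧ x ≠ q} ≃ₜ {y // y ≠ p' ∧ y ≠ q'} :=
    (e.trans ((Homeomorph.refl A).prodCongr θI)).trans e'.symm
  have hE : ∀ x, v (E x) = θ (u x) := fun x => by
    rw [← he', ← he x]
    simp [E, θI]
  have hE' : ∀ y, u (E.symm y) = θ.symm (v y) := fun y => by
    rw [Homeomorph.eq_symm_apply, ← hE, E.apply_symm_apply]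
  refine ⟨{ toFun := extendTwoPoints p q p' q' E
            invFun := extendTwoPoints p' q' p q E.symm
            left_inv := extendTwoPoints_leftInverse hpq hpq' E.toEquiv
            right_inv := extendTwoPoints_leftInverse hpq' hpq E.symm.toEquiv
            continuous_toFun := continuous_extendTwoPoints hpq E.continuous hu hv θ.continuous
              hp hq hE (fun y => (huniq' y).1) fun y => (huniq' y).2
            continuous_invFun := continuous_extendTwoPoints hpq' E.symm.continuous hv hu
              θ.symm.continuous (by rw [hp, θ.symm_apply_apply]) (by rw [hq, θ.symm_apply_apply])
              hE' (fun y => (huniq y).1) fun y => (huniq y).2 }, θ, hmonoθ, ?_⟩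
  exact extendTwoPoints_comp_eq hpq hp hq hE

end Assembly

section Sphere

theorem fact_finrank_space3 : Fact (Module.finrank ℝ Space3 = 2 + 1) :=
  ⟨finrank_euclideanSpace_fin⟩

/-- The unit sphere with two points removed is connected. -/
theorem connectedSpace_sphere_ne_and_ne {p q : Metric.sphere (0 : Space3) 1} (hpq : p ≠ q) :
    ConnectedSpace {x : Metric.sphere (0 : Space3) 1 // x ≠ p ∧ x ≠ q} := by
  have hp : ‖(p : Space3)‖ = 1 := norm_eq_of_mem_sphere p
  have hrank : 1 < Module.rank ℝ (ℝ ∙ (p : Space3))ᗮ := by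
    have h := Submodule.finrank_add_finrank_orthogonal (ℝ ∙ (p : Space3))
    rw [finrank_euclideanSpace, Fintype.card_fin,
      finrank_span_singleton (ne_zero_of_mem_unit_sphere p)] at h
    rw [← Module.finrank_eq_rank]
    exact_mod_cast (by omega : 1 < Module.finrank ℝ (ℝ ∙ (p : Space3))ᗮ)
  have hrange := range_stereographic_symm hp p.2
  obtain ⟨s, hs⟩ : q ∈ range (stereographic hp).symm := by
    rw [hrange]
    exact hpq.symm
  have h := (isConnected_compl_singleton_of_one_lt_rank hrank s).image _
    (isOpenEmbedding_stereographic_symm hp).continuous.continuousOn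
  rw [image_compl_eq_range_sdiff_image (isOpenEmbedding_stereographic_symm hp).injective,
    image_singleton, hs, hrange] at h
  exact isConnected_iff_connectedSpace.1 h

/-- A smooth function on the unit sphere extends to a compactly supported smooth function. -/
theorem exists_contDiff_extension {f : Metric.sphere (0 : Space3) 1 → ℝ}
    (hf : ContMDiff (𝓡 2) 𝓘(ℝ) (⊤ : ℕ∞) f) :
    ∃ F : Space3 → ℝ, ContDiff ℝ 2 F ∧ HasCompactSupport F ∧
      ∀ x : Metric.sphere (0 : Space3) 1, F x = f x := by
  classical
  have := fact_finrank_space3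
  let b : ContDiffBump (1 : ℝ) := ⟨1 / 4, 1 / 2, by norm_num, by norm_num⟩
  let U : TopologicalSpace.Opens Space3 := ⟨{0}ᶜ, isOpen_compl_singleton⟩
  have hmem : ∀ x : Space3, x ≠ 0 → ‖x‖⁻¹ • x ∈ Metric.sphere (0 : Space3) 1 := fun x hx => by
    rw [mem_sphere_zero_iff_norm]
    exact norm_smul_inv_norm (𝕜 := ℝ) hx
  let F : Space3 → ℝ := fun x =>
    if hx : x ≠ 0 then b (‖x‖ ^ 2) * f ⟨‖x‖⁻¹ • x, hmem x hx⟩ else 0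
  have hsupp : ∀ x, ‖x‖ ^ 2 ∉ Metric.ball (1 : ℝ) (1 / 2) → F x = 0 := fun x hx => by
    by_cases hx0 : x ≠ 0
    · have : b (‖x‖ ^ 2) = 0 := b.zero_of_le_dist (not_lt.1 hx)
      simp [F, this]
    · simp [F, hx0]
  refine ⟨F, contDiff_iff_contDiffAt.2 fun x => ?_, ?_, fun x => ?_⟩
  · by_cases hx : x = 0
    · have h : F =ᶠ[𝓝 x] fun _ => 0 := by
        have hlt : ∀ᶠ y in 𝓝 x, ‖y‖ ^ 2 < 1 / 2 :=
          (continuous_norm.pow 2).continuousAt.eventually_lt continuousAt_const (by simp [hx])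
        filter_upwards [hlt] with y hy
        refine hsupp y fun h => ?_
        rw [Real.ball_eq_Ioo] at h
        linarith [h.1]
      exact contDiffAt_const.congr_of_eventuallyEq h
    · have hU : ContMDiff 𝓘(ℝ, Space3) 𝓘(ℝ, Space3) 2
          fun y : U => ‖(y : Space3)‖⁻¹ • (y : Space3) := fun y => by
        have hy : (y : Space3) ≠ 0 := y.2
        refine contMDiffAt_subtype_iff (U := U) (f := fun y : Space3 => ‖y‖⁻¹ • y) |>.2 ?_
        exact (((contDiffAt_norm ℝ hy).inv (norm_ne_zero_iff.2 hy)).smul contDiffAt_id).contMDiffAt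
      have hs := hU.codRestrict_sphere (n := 2) fun y => hmem y y.2
      have hfs := (hf.of_le (m := 2) (WithTop.coe_le_coe.2 (le_top (a := (2 : ℕ∞))))).comp hs
      have hb : ContMDiff 𝓘(ℝ, Space3) 𝓘(ℝ) 2 fun y : U => b (‖(y : Space3)‖ ^ 2) := fun y =>
        contMDiffAt_subtype_iff (U := U) (f := fun y : Space3 => b (‖y‖ ^ 2)) |>.2
          (b.contDiff.comp (contDiff_norm_sq ℝ)).contMDiff.contMDiffAt
      have hFU : ContMDiff 𝓘(ℝ, Space3) 𝓘(ℝ) 2 fun y : U => F y := by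
        refine (hb.mul hfs).congr fun y => ?_
        have hy : (y : Space3) ≠ 0 := y.2
        simp only [F, dif_pos hy]
        rfl
      exact (contMDiffAt_subtype_iff (U := U) (x := ⟨x, hx⟩).1 hFU.contMDiffAt).contDiffAt
  · refine HasCompactSupport.intro (isCompact_closedBall (0 : Space3) 2) fun x hx => hsupp x ?_
    intro h
    rw [mem_closedBall_zero_iff, not_le] at hx
    rw [Real.ball_eq_Ioo] at h
    nlinarith [h.2]
  · have hx : (x : Space3) ≠ 0 := ne_zero_of_mem_unit_sphere x
    have hb : b 1 = 1 := b.one_of_mem_closedBall (Metric.mem_closedBall_self b.rIn_pos.le)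
    simp [F, hx, hb]

/-- A point of the sphere at which the tangential gradient vanishes is a critical point of the
restriction to the sphere. -/
theorem mfderiv_eq_zero_of_rotGrad_eq_zero {F : Space3 → ℝ} (hF : ContDiff ℝ 2 F)
    {f : Metric.sphere (0 : Space3) 1 → ℝ} (hFf : ∀ x : Metric.sphere (0 : Space3) 1, F x = f x)
    {x : Metric.sphere (0 : Space3) 1} (hx : rotGrad F x = 0) :
    mfderiv (𝓡 2) 𝓘(ℝ) f x = 0 := by
  have := fact_finrank_space3
  obtain rfl : f = F ∘ Subtype.val := funext fun x => (hFf x).symm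
  have hFd : MDifferentiableAt 𝓘(ℝ, Space3) 𝓘(ℝ) F (x : Space3) :=
    (hF.differentiable two_ne_zero).differentiableAt.mdifferentiableAt
  have hcoe : MDifferentiableAt (𝓡 2) 𝓘(ℝ, Space3)
      (Subtype.val : Metric.sphere (0 : Space3) 1 → Space3) x :=
    (contMDiff_coe_sphere (m := 1) x).mdifferentiableAt one_ne_zero
  rw [mfderiv_comp x hFd hcoe, mfderiv_eq_fderiv]
  ext w
  have hw : (mvfderiv (𝓡 2) (Subtype.val : Metric.sphere (0 : Space3) 1 → Space3) x) w ∈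
      (ℝ ∙ (x : Space3))ᗮ := by
    rw [← range_mvfderiv_subtypeVal (n := 2) x]
    exact LinearMap.mem_range_self _ w
  rw [Submodule.mem_orthogonal_singleton_iff_inner_right] at hw
  set v : Space3 := (mvfderiv (𝓡 2) (Subtype.val : Metric.sphere (0 : Space3) 1 → Space3) x) w
  change fderiv ℝ F x v = 0
  have h := cross3_cross3_self (x : Space3) (gradient F x)
  rw [show cross3 x (gradient F x) = 0 from hx, cross3_zero_left, real_inner_self_eq_norm_sq,
    norm_eq_of_mem_sphere, one_pow, one_smul, eq_comm, sub_eq_zero] at h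
  rw [← inner_gradient_eq_fderiv, h, real_inner_smul_left, hw, mul_zero]

end Sphere

section SphereFunctions

/-- A smooth function on the sphere with exactly two critical points takes its minimum and its
maximum only at these points, and looks like the projection of an open cylinder elsewhere. -/
theorem exists_cylinder_coordinates {f : Metric.sphere (0 : Space3) 1 → ℝ}
    (hf : ContMDiff (𝓡 2) 𝓘(ℝ) (⊤ : ℕ∞) f)
    (hfc : {x | mfderiv (𝓡 2) 𝓘(ℝ) f x = 0}.encard = 2) :
    ∃ p q, f q < f p ∧ (∀ x, x ≠ p → x ≠ q → f x ∈ Ioo (f q) (f p)) ∧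
      ∃ e : {x // x ≠ p ∧ x ≠ q} ≃ₜ AddCircle (1 : ℝ) × Ioo (f q) (f p),
        ∀ x, ((e x).2 : ℝ) = f x := by
  obtain ⟨F, hF, hFc, hFf⟩ := exists_contDiff_extension hf
  have hfcont : Continuous f := hf.continuous
  obtain ⟨φ, hφ, hφ0⟩ :=
    exists_flow_of_hasCompactSupport (contDiff_tangGrad hF) (hasCompactSupport_tangGrad hFc)
  obtain ⟨ψ, hψ, -⟩ :=
    exists_flow_of_hasCompactSupport (contDiff_rotGrad hF) (hasCompactSupport_rotGrad hFc)
  have hφS := isInvariant_sphere inner_self_tangGrad hφ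
  have hψS := isInvariant_sphere inner_self_rotGrad hψ
  let φS : Flow ℝ (Metric.sphere (0 : Space3) 1) := φ.restrict hφS
  let ψS : Flow ℝ (Metric.sphere (0 : Space3) 1) := ψ.restrict hψS
  have hderiv : ∀ x t, HasDerivAt (fun s => F (φ s x)) (‖rotGrad F (φ t x)‖ ^ 2) t := fun x t => by
    rw [← inner_gradient_tangGrad]
    exact hasDerivAt_comp_curve hF (hφ x t)
  have hψF : ∀ x t, F (ψ t x) = F x := fun x t => by
    have h : ∀ t, HasDerivAt (fun s => F (ψ s x)) 0 t := fun t => by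
      rw [← inner_gradient_rotGrad (F := F) (ψ t x)]
      exact hasDerivAt_comp_curve hF (hψ x t)
    simpa using is_const_of_deriv_eq_zero (fun t => (h t).differentiableAt)
      (fun t => (h t).deriv) t 0
  have hextr : ∀ x : Metric.sphere (0 : Space3) 1, IsExtrOn f univ x → rotGrad F x = 0 := by
    intro x hx
    have h : IsLocalExtr (fun s => F (φ s x)) 0 := by
      refine (hx.elim (fun h => Or.inl ?_) fun h => Or.inr ?_) <;>
      · refine Eventually.of_forall fun s => ?_
        simpa [hFf, φS, ← hFf (φS s x)] using h (mem_univ (φS s x))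
    simpa using h.hasDerivAt_eq_zero (hderiv x 0)
  have hcrit : ∀ x : Metric.sphere (0 : Space3) 1, rotGrad F x = 0 →
      x ∈ {x | mfderiv (𝓡 2) 𝓘(ℝ) f x = 0} :=
    fun x hx => mfderiv_eq_zero_of_rotGrad_eq_zero hF hFf hx
  obtain ⟨p, hp, q, hq, hlt, hcritpq⟩ : ∃ p, (∀ x, f x ≤ f p) ∧ ∃ q, (∀ x, f q ≤ f x) ∧ f q < f p ∧
      ∀ x : Metric.sphere (0 : Space3) 1, rotGrad F x = 0 → x = p ∨ x = q := by
    obtain ⟨a, b, hab, hset⟩ := encard_eq_two.1 hfc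
    have : Nonempty (Metric.sphere (0 : Space3) 1) := ⟨a⟩
    obtain ⟨p, -, hp⟩ := isCompact_univ.exists_isMaxOn univ_nonempty hfcont.continuousOn
    obtain ⟨q, -, hq⟩ := isCompact_univ.exists_isMinOn univ_nonempty hfcont.continuousOn
    have hmem : ∀ x : Metric.sphere (0 : Space3) 1, rotGrad F x = 0 → x = a ∨ x = b :=
      fun x hx => by simpa [hset] using hcrit x hx
    have hlt : f q < f p := by
      by_contra! hle
      obtain ⟨⟨x, hxa, hxb⟩⟩ := (connectedSpace_sphere_ne_and_ne hab).toNonempty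
      rcases hmem x (hextr x (Or.inr fun y hy => (hp hy).trans (hle.trans (hq (mem_univ x)))))
        with h | h
      exacts [hxa h, hxb h]
    have hpq : p ≠ q := fun h => hlt.ne (by rw [h])
    refine ⟨p, fun x => hp (mem_univ x), q, fun x => hq (mem_univ x), hlt, fun x hx => ?_⟩
    have h1 := hmem x hx
    have h2 := hmem p (hextr p (Or.inr hp))
    have h3 := hmem q (hextr q (Or.inl hq))
    grind
  have hpq : p ≠ q := fun h => hlt.ne (by rw [h])
  have hrot : ∀ x : Metric.sphere (0 : Space3) 1, x ≠ p → x ≠ q → rotGrad F x ≠ 0 :=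
    fun x hxp hxq h => (hcritpq x h).elim hxp hxq
  have hmem : ∀ x, x ≠ p → x ≠ q → f x ∈ Ioo (f q) (f p) := fun x hxp hxq =>
    ⟨(hq x).lt_of_ne fun h => hrot x hxp hxq (hextr x (Or.inl fun y _ => h ▸ hq y)),
      (hp x).lt_of_ne fun h => hrot x hxp hxq (hextr x (Or.inr fun y _ => h ▸ hp y))⟩
  have hfixed : ∀ x : Metric.sphere (0 : Space3) 1, IsExtrOn f univ x → ∀ t, φS t x = x :=
    fun x hx t => Subtype.ext (hφ0 x (by simp [tangGrad, hextr x hx]) t)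
  have hφp := hfixed p (Or.inr fun x _ => hp x)
  have hφq := hfixed q (Or.inl fun x _ => hq x)
  have hne : ∀ x, x ≠ p → x ≠ q → ∀ t, φS t x ≠ p ∧ φS t x ≠ q := by
    have h : ∀ t x y, (∀ s, φS s y = y) → φS t x = y → x = y := fun t x y hy hxy => by
      rw [← hy (-t), ← hxy, ← φS.map_add, neg_add_cancel, φS.map_zero_apply]
    exact fun x hxp hxq t => ⟨fun h0 => hxp (h t x p hφp h0), fun h0 => hxq (h t x q hφq h0)⟩
  have hderivS : ∀ x t, HasDerivAt (fun s => f (φS s x)) (‖rotGrad F (φS t x)‖ ^ 2) t :=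
    fun x t => by
      simp_rw [← hFf]
      exact hderiv x t
  have hnormcont : Continuous fun x : Metric.sphere (0 : Space3) 1 => ‖rotGrad F x‖ ^ 2 :=
    ((contDiff_rotGrad hF).continuous.comp continuous_subtype_val).norm.pow 2
  have := connectedSpace_sphere_ne_and_ne hpq
  refine ⟨p, q, hlt, hmem, exists_homeomorph_addCircle_prod hfcont hlt hmem (φ := φS) (ψ := ψS)
    hφp hφq ?_ ?_ ?_ ?_ ?_⟩
  · intro x hxp hxq
    refine strictMono_of_deriv_pos fun t => ?_
    rw [(hderivS x t).deriv]
    have := hrot _ (hne x hxp hxq t).1 (hne x hxp hxq t).2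
    positivity
  · intro x hxp hxq c hc
    refine exists_eq_of_hasDerivAt (hderivS x) (fun t => sq_nonneg _)
      (fun t => hmem _ (hne x hxp hxq t).1 (hne x hxp hxq t).2) (fun a b ha hb => ?_) hc
    obtain ⟨δ, hδ, h⟩ := (isClosed_Icc.preimage hfcont).isCompact.exists_forall_le'
      (s := f ⁻¹' Icc a b) hnormcont.continuousOn (a := 0) fun y hy => by
        have := hrot y (fun h => (hy.2.trans_lt hb).ne (by rw [h]))
          (fun h => (ha.trans_le hy.1).ne (by rw [h]))
        positivity
    exact ⟨δ, hδ, fun t ht => h _ ht⟩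
  · intro t x
    rw [← hFf, ← hFf]
    exact hψF x t
  · intro x hxp hxq
    by_contra! h
    have h0 : HasDerivAt (fun s => ψ s x) 0 0 := by
      simpa only [show (fun s => ψ s x) = fun _ => (x : Space3) from
        funext fun s => congrArg Subtype.val (h s)] using hasDerivAt_const (0 : ℝ) (x : Space3)
    have h1 := hψ x 0
    rw [ψ.map_zero_apply] at h1
    exact hrot x hxp hxq (h1.unique h0)
  · intro x hxp hxq ε hε
    obtain ⟨N, hN, h⟩ :=
      exists_nhds_forall_exists_flow_eq hF hψ hψF x.2 (hrot x hxp hxq) hε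
    refine ⟨Subtype.val ⁻¹' N, continuous_subtype_val.continuousAt.preimage_mem_nhds hN,
      fun y hy hyx => ?_⟩
    obtain ⟨t, ht, hty⟩ := h y hy y.2 (by rw [hFf, hFf, hyx])
    exact ⟨t, ht, Subtype.ext hty⟩

end SphereFunctions

/-- **Section 3 (sphere).** Any two smooth functions on the sphere `S²` having exactly
two critical points are topologically conjugate. -/
theorem minimal_functions_on_sphere_conjugate
    (f g : (Metric.sphere (0 : EuclideanSpace ℝ (Fin 3)) 1) → ℝ)
    (hf : ContMDiff (𝓡 2) 𝓘(ℝ) (⊤ : ℕ∞) f) (hg : ContMDiff (𝓡 2) 𝓘(ℝ) (⊤ : ℕ∞) g)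
    (hfc : {x | mfderiv (𝓡 2) 𝓘(ℝ) f x = 0}.encard = 2)
    (hgc : {x | mfderiv (𝓡 2) 𝓘(ℝ) g x = 0}.encard = 2) :
    ∃ (h : (Metric.sphere (0 : EuclideanSpace ℝ (Fin 3)) 1) ≃ₜ
        (Metric.sphere (0 : EuclideanSpace ℝ (Fin 3)) 1)) (h' : ℝ ≃ₜ ℝ),
      StrictMono h' ∧ ∀ x, f (h x) = h' (g x) := by
  obtain ⟨p', q', hlt', hmem', e', he'⟩ := exists_cylinder_coordinates hf hfc
  obtain ⟨p, q, hlt, hmem, e, he⟩ := exists_cylinder_coordinates hg hgc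
  exact exists_conjugation hg.continuous hf.continuous hlt hlt' hmem hmem' e he e' he'
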